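/- Let μ ∈ ℤⁿ, let y₁ = τ_α(y(p,e,b,g)) for some p ∈ ℂ, e ∈ ℂ×, b, g ∈ ℂ^{k−1}, and let y₂ ∈ Gr_{μ+α}. Then y₁·y₂ ∈ N(K)^α₁ · t^μ · T₁[[t⁻¹]] · N₋(K). -/

import Mathlib

open Matrix

noncomputable section

/-- `K = ℂ((t⁻¹))`, the field of formal Laurent series in `t⁻¹`.  We realize it as
`LaurentSeries ℂ`, where the Laurent-series variable `X` plays the role of `t⁻¹`;
thus for `f : K`, `f.coeff j` is the coefficient of `t^{-j}`. -/
abbrev K : Type := LaurentSeries ℂ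

/-- The element `t` (the inverse of the Laurent series variable). -/
def tK : K := (HahnSeries.single (-1 : ℤ) (1 : ℂ))

/-- The constant embedding `ℂ → K`. -/
def Cc (z : ℂ) : K := HahnSeries.C z

/-- `f ∈ 𝒪 = ℂ[[t⁻¹]]` : no positive powers of `t`. -/
def memO (f : K) : Prop := ∀ j : ℤ, j < 0 → f.coeff j = 0

/-- `f ∈ 𝒪₁ = t⁻¹ℂ[[t⁻¹]]`. -/
def memO1 (f : K) : Prop := ∀ j : ℤ, j ≤ 0 → f.coeff j = 0

/-- `f ∈ ℂ[t]`. -/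
def memPoly (f : K) : Prop := ∀ j : ℤ, 0 < j → f.coeff j = 0

/-- Upper unitriangular matrix. -/
def IsUpperUni {R : Type*} [Zero R] [One R] {m : ℕ} (M : Matrix (Fin m) (Fin m) R) : Prop :=
  (∀ i, M i i = 1) ∧ ∀ i j : Fin m, j < i → M i j = 0

/-- Lower unitriangular matrix. -/
def IsLowerUni {R : Type*} [Zero R] [One R] {m : ℕ} (M : Matrix (Fin m) (Fin m) R) : Prop :=
  (∀ i, M i i = 1) ∧ ∀ i j : Fin m, i < j → M i j = 0

/-- `M ∈ N₁[[t⁻¹]]` : upper unitriangular with off-diagonal entries in `𝒪₁`. -/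
def MemN1 {m : ℕ} (M : Matrix (Fin m) (Fin m) K) : Prop :=
  IsUpperUni M ∧ ∀ i j : Fin m, i ≠ j → memO1 (M i j)

/-- `M ∈ N₋,₁[[t⁻¹]]`. -/
def MemN1neg {m : ℕ} (M : Matrix (Fin m) (Fin m) K) : Prop :=
  IsLowerUni M ∧ ∀ i j : Fin m, i ≠ j → memO1 (M i j)

/-- `M ∈ T₁[[t⁻¹]]` : diagonal with entries in `1 + 𝒪₁`. -/
def MemT1 {m : ℕ} (M : Matrix (Fin m) (Fin m) K) : Prop :=
  (∀ i j : Fin m, i ≠ j → M i j = 0) ∧ ∀ i, memO1 (M i i - 1)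

/-- `M ∈ N[t]` : upper unitriangular with entries in `ℂ[t]`. -/
def MemNpoly {m : ℕ} (M : Matrix (Fin m) (Fin m) K) : Prop :=
  IsUpperUni M ∧ ∀ i j : Fin m, memPoly (M i j)

/-- `M ∈ N₋[t]` : lower unitriangular with entries in `ℂ[t]`. -/
def MemNnegPoly {m : ℕ} (M : Matrix (Fin m) (Fin m) K) : Prop :=
  IsLowerUni M ∧ ∀ i j : Fin m, memPoly (M i j)

/-- `t^ν = diag(t^{ν₁},…,t^{ν_m})`. -/
def tPow {m : ℕ} (ν : Fin m → ℤ) : Matrix (Fin m) (Fin m) K :=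
  Matrix.diagonal fun i => tK ^ ν i

/-- `y = u · h · t^ν · l` is a Gauss factorization exhibiting membership in `Gr_ν`. -/
def IsGauss {m : ℕ} (ν : Fin m → ℤ) (y u h l : Matrix (Fin m) (Fin m) K) : Prop :=
  MemN1 u ∧ MemT1 h ∧ MemN1neg l ∧ y = u * h * tPow ν * l

/-- The matrix slice `Gr_ν = N₁[[t⁻¹]]·T₁[[t⁻¹]]·t^ν·N₋,₁[[t⁻¹]]`. -/
def GrSlice {m : ℕ} (ν : Fin m → ℤ) : Set (Matrix (Fin m) (Fin m) K) :=
  { y | ∃ u h l, IsGauss ν y u h l }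

/-- Block embedding `τ_α : Mat_{k+1} → Mat_n` into (1-indexed) rows and columns `r₁,…,r₁+k`,
identity outside this block. -/
def blockEmbed {R : Type*} [Zero R] [One R] (n r₁ k : ℕ)
    (g : Matrix (Fin (k+1)) (Fin (k+1)) R) : Matrix (Fin n) (Fin n) R :=
  fun i j =>
    if h : r₁ - 1 ≤ (i : ℕ) ∧ (i : ℕ) ≤ r₁ - 1 + k ∧ r₁ - 1 ≤ (j : ℕ) ∧ (j : ℕ) ≤ r₁ - 1 + k then
      g ⟨(i : ℕ) - (r₁ - 1), by omega⟩ ⟨(j : ℕ) - (r₁ - 1), by omega⟩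
    else if i = j then 1 else 0

/-- The coweight `α` of `PGL_n` : `α_{r₁} = 1`, `α_{r₂+1} = -1` (1-indexed), all other
entries `0`. -/
def alphaCo (n r₁ r₂ : ℕ) : Fin n → ℤ :=
  fun i => if (i : ℕ) = r₁ - 1 then 1 else if (i : ℕ) = r₂ then -1 else 0

/-- The matrix `y(p,e,b,g)` (matrix representative of a point of the open Zastava
`Gr⁰_{-α}`), a `(k+1)×(k+1)` matrix over `ℂ[t] ⊆ K`. -/
def ymat (k : ℕ) (p e : ℂ) (b g : Fin (k-1) → ℂ) :
    Matrix (Fin (k+1)) (Fin (k+1)) K :=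
  fun i j =>
    if _hi0 : (i : ℕ) = 0 then
      (if _hjk : (j : ℕ) = k then Cc e else 0)
    else if _hik : (i : ℕ) = k then
      (if _hj0 : (j : ℕ) = 0 then Cc (-e⁻¹)
       else if _hjk : (j : ℕ) = k then tK - Cc (p + ∑ l : Fin (k-1), b l * g l)
       else Cc (-(g ⟨k - (j : ℕ) - 1, by have := j.isLt; omega⟩)))
    else
      (if _hji : (j : ℕ) = (i : ℕ) then 1
       else if _hjk : (j : ℕ) = k then Cc (b ⟨k - (i : ℕ) - 1, by have := i.isLt; omega⟩)
       else 0)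

/-- The matrix `x₋(v)` over `K` : identity except for the bottom row `(v_k,…,v₁,1)`. -/
def xminusK (k : ℕ) (v : Fin k → ℂ) : Matrix (Fin (k+1)) (Fin (k+1)) K :=
  fun i j =>
    if _hik : (i : ℕ) = k then
      (if _hjk : (j : ℕ) = k then 1 else Cc (v ⟨k - (j : ℕ) - 1, by have := j.isLt; omega⟩))
    else if i = j then 1 else 0

/-- `Φ_α(y)` read off from the `N₁[[t⁻¹]]`-factor `u` of a Gauss factorization of `y`. -/
def PhiOf (n r₂ k : ℕ) (hrn : r₂ < n) (u : Matrix (Fin n) (Fin n) K) : Fin k → ℂ :=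
  fun a => (u ⟨r₂ - 1 - (a : ℕ), by omega⟩ ⟨r₂, hrn⟩).coeff 1

/-- `ζ_α(y)` read off from the `N₁[[t⁻¹]]`-factor `u` of a Gauss factorization of `y`. -/
def ZetaOf (n r₁ r₂ k : ℕ) (hr1 : 1 ≤ r₁) (hrr : r₁ ≤ r₂) (hrn : r₂ < n)
    (hk : k = r₂ - r₁ + 1) (u : Matrix (Fin n) (Fin n) K) : Fin k → ℂ :=
  fun a =>
    if _ha : (a : ℕ) = k - 1 then (u ⟨r₁ - 1, by omega⟩ ⟨r₂, hrn⟩).coeff 2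
    else (u ⟨r₁ - 1, by omega⟩ ⟨r₁ + (a : ℕ), by have := a.isLt; omega⟩).coeff 1

/-- `ξ_α(y)`, computed from the `N₁[[t⁻¹]]`-factor `u` of a Gauss factorization of `y`. -/
def xiOf (n r₁ r₂ k : ℕ) (hr1 : 1 ≤ r₁) (hrr : r₁ ≤ r₂) (hrn : r₂ < n)
    (hk : k = r₂ - r₁ + 1) (u : Matrix (Fin n) (Fin n) K) : Matrix (Fin n) (Fin n) K :=
  let c := PhiOf n r₂ k hrn u
  let z := ZetaOf n r₁ r₂ k hr1 hrr hrn hk u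
  let e : ℂ := c ⟨k - 1, by omega⟩
  let b : Fin (k-1) → ℂ := fun i => c ⟨(i : ℕ), by have := i.isLt; omega⟩
  let g : Fin (k-1) → ℂ := fun i => z ⟨k - (i : ℕ) - 2, by omega⟩ / e
  let p : ℂ := z ⟨k - 1, by omega⟩ / e - ∑ i : Fin (k-1), b i * g i
  blockEmbed n r₁ k (ymat k p e b g)

/-- `M` has identity submatrix in (1-indexed) rows and columns `r₁,…,r₁+k`. -/
def HasIdBlock {R : Type*} [Zero R] [One R] {n : ℕ} (r₁ k : ℕ)
    (M : Matrix (Fin n) (Fin n) R) : Prop :=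
  ∀ i j : Fin n, r₁ - 1 ≤ (i : ℕ) → (i : ℕ) ≤ r₁ - 1 + k →
    r₁ - 1 ≤ (j : ℕ) → (j : ℕ) ≤ r₁ - 1 + k →
    M i j = if i = j then 1 else 0

/-- `M ∈ N^α(K)` : upper unitriangular over `K` with identity `(k+1)×(k+1)`-block. -/
def MemNalphaK (n r₁ k : ℕ) (M : Matrix (Fin n) (Fin n) K) : Prop :=
  IsUpperUni M ∧ HasIdBlock r₁ k M

/-- `M ∈ N^α[t]`. -/
def MemNalphaPoly (n r₁ k : ℕ) (M : Matrix (Fin n) (Fin n) K) : Prop :=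
  MemNalphaK n r₁ k M ∧ ∀ i j : Fin n, memPoly (M i j)

/-- `M ∈ N(K)^α₁ = x_α(N_{1,k+1}[[t⁻¹]])·N^α(K)`. -/
def MemNKalpha1 (n r₁ k : ℕ) (M : Matrix (Fin n) (Fin n) K) : Prop :=
  ∃ (a : Matrix (Fin (k+1)) (Fin (k+1)) K) (u : Matrix (Fin n) (Fin n) K),
    MemN1 a ∧ MemNalphaK n r₁ k u ∧ M = blockEmbed n r₁ k a * u

/-- `z = π(x)` for the slice `Gr_ν` : `z ∈ Gr_ν` and `z = a·x·b` with `a ∈ N[t]`,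
`b ∈ N₋[t]`. -/
def IsPiOf {n : ℕ} (ν : Fin n → ℤ) (x z : Matrix (Fin n) (Fin n) K) : Prop :=
  z ∈ GrSlice ν ∧ ∃ a b, MemNpoly a ∧ MemNnegPoly b ∧ z = a * x * b

/-- The open Zastava slice `Gr⁰_{-α} ⊆ GL_n(K)` : matrices `τ_α(y(p,e,b,g))`. -/
def GrZeroNegAlpha (n r₁ k : ℕ) : Set (Matrix (Fin n) (Fin n) K) :=
  { M | ∃ (p e : ℂ) (b g : Fin (k-1) → ℂ), e ≠ 0 ∧ M = blockEmbed n r₁ k (ymat k p e b g) }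

/-- `μ + α`. -/
def addAlpha (n r₁ r₂ : ℕ) (μ : Fin n → ℤ) : Fin n → ℤ :=
  fun i => μ i + alphaCo n r₁ r₂ i


section Integrality

theorem memO1.integral {f : K} (hf : memO1 f) : memO f := fun j hj => hf j hj.le

theorem memO_zero : memO 0 := fun _ _ => rfl

theorem memO1_zero : memO1 0 := fun _ _ => rfl

theorem memO_C (z : ℂ) : memO (Cc z) := fun j hj => by
  simp [Cc, HahnSeries.C_apply, HahnSeries.coeff_single_of_ne hj.ne]

theorem memO_one : memO 1 := by simpa [Cc] using memO_C 1

theorem memO.add {f g : K} (hf : memO f) (hg : memO g) : memO (f + g) := fun j hj => by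
  simp [hf j hj, hg j hj]

theorem memO1.add {f g : K} (hf : memO1 f) (hg : memO1 g) : memO1 (f + g) := fun j hj => by
  simp [hf j hj, hg j hj]

theorem memO.neg {f : K} (hf : memO f) : memO (-f) := fun j hj => by
  simp [hf j hj]

theorem memO1.neg {f : K} (hf : memO1 f) : memO1 (-f) := fun j hj => by
  simp [hf j hj]

theorem memO.sub {f g : K} (hf : memO f) (hg : memO g) : memO (f - g) := by
  simpa [sub_eq_add_neg] using hf.add hg.neg

theorem memO1.sub {f g : K} (hf : memO1 f) (hg : memO1 g) : memO1 (f - g) := by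
  simpa [sub_eq_add_neg] using hf.add hg.neg

theorem coeff_mul_eq_zero_of_lt {f g : K} {a b : ℤ} (hf : ∀ j < a, f.coeff j = 0)
    (hg : ∀ j < b, g.coeff j = 0) : ∀ j < a + b, (f * g).coeff j = 0 := by
  intro j hj
  rw [HahnSeries.coeff_mul]
  refine Finset.sum_eq_zero fun x hx => ?_
  have hx' : x.1 + x.2 = j := by simp at hx; exact hx.2.2
  rcases lt_or_ge x.1 a with h | h
  · rw [hf _ h, zero_mul]
  · rw [hg _ (by omega), mul_zero]

theorem memO.mul {f g : K} (hf : memO f) (hg : memO g) : memO (f * g) :=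
  coeff_mul_eq_zero_of_lt hf hg

theorem memO1.mul_memO {f g : K} (hf : memO1 f) (hg : memO g) : memO1 (f * g) := fun j hj =>
  coeff_mul_eq_zero_of_lt (a := 1) (b := 0) (fun i hi => hf i (by omega)) hg j (by omega)

theorem memO.mul_memO1 {f g : K} (hf : memO f) (hg : memO1 g) : memO1 (f * g) := by
  rw [mul_comm]; exact hg.mul_memO hf

theorem memO_sum {ι : Type*} (s : Finset ι) {f : ι → K} (hf : ∀ i ∈ s, memO (f i)) :
    memO (∑ i ∈ s, f i) :=
  Finset.sum_induction f memO (fun _ _ => memO.add) memO_zero hf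

theorem tK_ne_zero : tK ≠ 0 := by simp [tK]

theorem tK_inv : tK⁻¹ = HahnSeries.single (1 : ℤ) (1 : ℂ) := by
  refine inv_eq_of_mul_eq_one_left ?_
  simp [tK]

theorem memO1_tK_inv : memO1 tK⁻¹ := fun j hj => by
  rw [tK_inv, HahnSeries.coeff_single_of_ne (by omega)]

theorem memO1.tK_mul {f : K} (hf : memO1 f) : memO (tK * f) := fun j hj => by
  rw [tK, HahnSeries.coeff_single_mul, hf _ (by omega), mul_zero]

theorem memO_of_one_add {f : K} (hf : memO1 (f - 1)) : memO f := by
  simpa using hf.integral.add memO_one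

theorem ne_zero_of_one_add {f : K} (hf : memO1 (f - 1)) : f ≠ 0 := by
  rintro rfl
  simpa using hf 0 le_rfl

theorem memO_inv_of_one_add {f : K} (hf : memO1 (f - 1)) : memO f⁻¹ := by
  have h0 := ne_zero_of_one_add hf
  have hle : f.order ≤ 0 := by
    apply HahnSeries.order_le_of_coeff_ne_zero
    have h := hf 0 le_rfl
    rw [HahnSeries.coeff_sub, sub_eq_zero] at h
    simp [h]
  have hmul : f.order + f⁻¹.order = 0 := by
    rw [← HahnSeries.order_mul h0 (inv_ne_zero h0), mul_inv_cancel₀ h0, HahnSeries.order_one]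
  exact fun j hj => HahnSeries.coeff_eq_zero_of_lt_order (by omega)

end Integrality

section Block

theorem blockEmbed_mul_apply_mem {R : Type*} [CommRing R] {n r₁ k : ℕ} (hn : r₁ - 1 + k < n)
    (g : Matrix (Fin (k + 1)) (Fin (k + 1)) R) (X : Matrix (Fin n) (Fin n) R)
    (q : Fin (k + 1)) (j : Fin n) :
    (blockEmbed n r₁ k g * X) ⟨r₁ - 1 + q, by omega⟩ j =
      ∑ s : Fin (k + 1), g q s * X ⟨r₁ - 1 + s, by omega⟩ j := by
  rw [Matrix.mul_apply]
  symm
  refine Finset.sum_of_injOn (fun s : Fin (k + 1) => (⟨r₁ - 1 + s, by omega⟩ : Fin n)) ?_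
    (fun _ _ => by simp) ?_ ?_
  · intro a _ b _ h
    simp only [Fin.mk.injEq] at h
    exact Fin.ext (by omega)
  · intro x _ hx
    have hx' : ¬ (r₁ - 1 ≤ (x : ℕ) ∧ (x : ℕ) ≤ r₁ - 1 + k) := by
      rintro ⟨h1, h2⟩
      refine hx ⟨⟨x - (r₁ - 1), by omega⟩, by simp, ?_⟩
      exact Fin.ext (by simp; omega)
    have hne : (⟨r₁ - 1 + q, by omega⟩ : Fin n) ≠ x := by
      rintro rfl
      exact hx' ⟨by simp, by simp; omega⟩
    simp only [blockEmbed]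
    rw [dif_neg (by tauto), if_neg hne, zero_mul]
  · intro s _
    simp only [blockEmbed]
    rw [dif_pos ⟨by omega, by omega, by omega, by omega⟩]
    simp

theorem blockEmbed_mul_apply_of_notMem {R : Type*} [CommRing R] {n r₁ k : ℕ}
    (g : Matrix (Fin (k + 1)) (Fin (k + 1)) R) (X : Matrix (Fin n) (Fin n) R)
    (i j : Fin n) (hi : ¬ (r₁ - 1 ≤ (i : ℕ) ∧ (i : ℕ) ≤ r₁ - 1 + k)) :
    (blockEmbed n r₁ k g * X) i j = X i j := by
  rw [Matrix.mul_apply, Finset.sum_eq_single i]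
  · simp only [blockEmbed]
    rw [dif_neg (by tauto)]
    simp
  · intro x _ hx
    simp only [blockEmbed]
    rw [dif_neg (by tauto), if_neg hx.symm, zero_mul]
  · simp

theorem exists_block_index {n r₁ k : ℕ} {i : Fin n}
    (hi : r₁ - 1 ≤ (i : ℕ) ∧ (i : ℕ) ≤ r₁ - 1 + k) :
    ∃ (q : Fin (k + 1)) (h : r₁ - 1 + (q : ℕ) < n), i = ⟨r₁ - 1 + q, h⟩ :=
  ⟨⟨i - (r₁ - 1), by omega⟩, by simp; omega, Fin.ext (by simp; omega)⟩

theorem memNKalpha1_of_isUpperUni {n r₁ k : ℕ} (hn : r₁ - 1 + k < n)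
    {w : Matrix (Fin n) (Fin n) K} (hw : IsUpperUni w)
    (hw1 : ∀ i j : Fin n, r₁ - 1 ≤ (i : ℕ) → i < j → (j : ℕ) ≤ r₁ - 1 + k → memO1 (w i j)) :
    MemNKalpha1 n r₁ k w := by
  let a : Matrix (Fin (k + 1)) (Fin (k + 1)) K := fun q s =>
    w ⟨r₁ - 1 + q, by omega⟩ ⟨r₁ - 1 + s, by omega⟩
  have ha : IsUpperUni a := ⟨fun q => hw.1 _, fun q s h => hw.2 _ _ (by
    rw [Fin.lt_def] at h ⊢; simp only; omega)⟩
  have hdet : IsUnit a.det := by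
    rw [Matrix.det_of_isUpperTriangular (fun i j h => ha.2 i j h)]
    simp [ha.1]
  have hblock : ∀ (q : Fin (k + 1)) (s : Fin (k + 1)),
      (blockEmbed n r₁ k a⁻¹ * w) ⟨r₁ - 1 + q, by omega⟩ ⟨r₁ - 1 + s, by omega⟩ =
        if q = s then 1 else 0 := by
    intro q s
    rw [blockEmbed_mul_apply_mem hn]
    change (a⁻¹ * a) q s = _
    rw [Matrix.nonsing_inv_mul _ hdet, Matrix.one_apply]
  refine ⟨a, blockEmbed n r₁ k a⁻¹ * w, ⟨ha, ?_⟩, ⟨⟨?_, ?_⟩, ?_⟩, ?_⟩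
  · intro q s hqs
    rcases lt_or_gt_of_ne hqs with h | h
    · refine hw1 _ _ (by simp) ?_ (by simp; omega)
      rw [Fin.lt_def] at h ⊢; simp only; omega
    · rw [ha.2 _ _ h]; exact memO1_zero
  · intro i
    by_cases hi : r₁ - 1 ≤ (i : ℕ) ∧ (i : ℕ) ≤ r₁ - 1 + k
    · obtain ⟨q, h, rfl⟩ := exists_block_index hi
      rw [hblock, if_pos rfl]
    · rw [blockEmbed_mul_apply_of_notMem _ _ _ _ hi, hw.1]
  · intro i j hij
    by_cases hi : r₁ - 1 ≤ (i : ℕ) ∧ (i : ℕ) ≤ r₁ - 1 + k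
    · by_cases hj : r₁ - 1 ≤ (j : ℕ) ∧ (j : ℕ) ≤ r₁ - 1 + k
      · obtain ⟨q, h, rfl⟩ := exists_block_index hi
        obtain ⟨s, h', rfl⟩ := exists_block_index hj
        rw [hblock, if_neg]
        rintro rfl
        exact lt_irrefl _ hij
      · obtain ⟨q, h, rfl⟩ := exists_block_index hi
        rw [blockEmbed_mul_apply_mem hn]
        refine Finset.sum_eq_zero fun s _ => ?_
        rw [hw.2, mul_zero]
        rw [Fin.lt_def] at hij ⊢
        simp only at hij ⊢
        omega
    · rw [blockEmbed_mul_apply_of_notMem _ _ _ _ hi, hw.2 _ _ hij]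
  · intro i j hi hi' hj hj'
    obtain ⟨q, h, rfl⟩ := exists_block_index ⟨hi, hi'⟩
    obtain ⟨s, h', rfl⟩ := exists_block_index ⟨hj, hj'⟩
    rw [hblock]
    congr 1
    simp [Fin.ext_iff]
  · refine Matrix.ext fun i j => ?_
    by_cases hi : r₁ - 1 ≤ (i : ℕ) ∧ (i : ℕ) ≤ r₁ - 1 + k
    · obtain ⟨q, h, rfl⟩ := exists_block_index hi
      rw [blockEmbed_mul_apply_mem hn]
      simp_rw [blockEmbed_mul_apply_mem hn]
      let v : Fin (k + 1) → K := fun s => w ⟨r₁ - 1 + s, by omega⟩ j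
      change v q = (a *ᵥ (a⁻¹ *ᵥ v)) q
      rw [Matrix.mulVec_mulVec, Matrix.mul_nonsing_inv _ hdet, Matrix.one_mulVec]
    · rw [blockEmbed_mul_apply_of_notMem _ _ _ _ hi, blockEmbed_mul_apply_of_notMem _ _ _ _ hi]

end Block

section Gauss

theorem mul_diagonal_mul_apply {n : ℕ} (w l : Matrix (Fin n) (Fin n) K) (d : Fin n → K)
    (i j : Fin n) :
    (w * Matrix.diagonal d * l) i j = ∑ x, w i x * d x * l x j := by
  simp_rw [Matrix.mul_apply (M := w * _), Matrix.mul_diagonal]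

theorem exists_gauss_of_block (lo hi n : ℕ) (M : Matrix (Fin n) (Fin n) K)
    (hdiag : ∀ i, memO1 (M i i - 1))
    (hupper : ∀ i j : Fin n, lo ≤ (i : ℕ) → i < j → (j : ℕ) ≤ hi → memO1 (M i j))
    (hlower : ∀ i j : Fin n, j < i → memO (M i j))
    (hzero : ∀ i j : Fin n, j < i → ((j : ℕ) < lo ∨ hi < (i : ℕ)) → M i j = 0) :
    ∃ (w l : Matrix (Fin n) (Fin n) K) (d : Fin n → K), IsUpperUni w ∧
      (∀ i j : Fin n, lo ≤ (i : ℕ) → i < j → (j : ℕ) ≤ hi → memO1 (w i j)) ∧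
      (∀ i, memO1 (d i - 1)) ∧ IsLowerUni l ∧ M = w * Matrix.diagonal d * l := by
  induction n with
  | zero => exact ⟨1, 1, 0, ⟨nofun, nofun⟩, nofun, nofun, ⟨nofun, nofun⟩, Subsingleton.elim _ _⟩
  | succ n ih =>
    set c : K := M (Fin.last n) (Fin.last n) with hc
    have hc1 : memO1 (c - 1) := hdiag _
    have hc0 : c ≠ 0 := ne_zero_of_one_add hc1
    have hcinv : memO c⁻¹ := memO_inv_of_one_add hc1
    have hlast : ∀ j : Fin n, memO (M (Fin.last n) j.castSucc) := fun j =>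
      hlower _ _ (Fin.castSucc_lt_last j)
    have hlast0 : ∀ j : Fin n, ((j : ℕ) < lo ∨ hi < n) → M (Fin.last n) j.castSucc = 0 :=
      fun j h => hzero _ _ (Fin.castSucc_lt_last j) (by simpa using h)
    have hcorr : ∀ i j : Fin n, lo ≤ (i : ℕ) →
        memO1 (M i.castSucc (Fin.last n) * M (Fin.last n) j.castSucc * c⁻¹) := by
      intro i j hi'
      by_cases h : (j : ℕ) < lo ∨ hi < n
      · rw [hlast0 j h]; simpa using memO1_zero
      · have hu := hupper i.castSucc (Fin.last n) (by simpa using hi') (Fin.castSucc_lt_last i)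
          (by simp; omega)
        exact (hu.mul_memO (hlast j)).mul_memO hcinv
    obtain ⟨w, l, d, hw, hw1, hd, hl, hM⟩ := ih
      (fun i j => M i.castSucc j.castSucc -
        M i.castSucc (Fin.last n) * M (Fin.last n) j.castSucc * c⁻¹)
      (by
        intro i
        by_cases h : (i : ℕ) < lo
        · rw [hlast0 i (Or.inl h)]; simpa using hdiag i.castSucc
        · rw [sub_right_comm]
          exact (hdiag _).sub (hcorr i i (by omega)))
      (by
        intro i j h1 h2 h3
        exact (hupper i.castSucc j.castSucc (by simpa using h1) (by simpa using h2)
          (by simpa using h3)).sub (hcorr i j h1))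
      (by
        intro i j h
        by_cases h' : (j : ℕ) < lo
        · rw [hlast0 j (Or.inl h')]; simpa using hlower i.castSucc j.castSucc (by simpa using h)
        · exact (hlower i.castSucc j.castSucc (by simpa using h)).sub
            (hcorr i j (by rw [Fin.lt_def] at h; omega)).integral)
      (by
        intro i j h h'
        rw [hzero i.castSucc j.castSucc (by simpa using h) (by simpa using h'),
          hlast0 j (h'.imp id fun h' => h'.trans i.isLt)]
        simp)
    refine ⟨fun i j => Fin.lastCases (Fin.lastCases 1 (fun _ => 0) j)
        (fun i' => Fin.lastCases (M i'.castSucc (Fin.last n) * c⁻¹) (fun j' => w i' j') j) i,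
      fun i j => Fin.lastCases
        (Fin.lastCases 1 (fun j' => M (Fin.last n) j'.castSucc * c⁻¹) j)
        (fun i' => Fin.lastCases 0 (fun j' => l i' j') j) i,
      fun i => Fin.lastCases c d i, ⟨?_, ?_⟩, ?_, ?_, ⟨?_, ?_⟩, ?_⟩
    · intro i
      cases i using Fin.lastCases <;> simp [hw.1]
    · intro i j hij
      cases i using Fin.lastCases with
      | last =>
        cases j using Fin.lastCases with
        | last => exact absurd hij (lt_irrefl _)
        | cast j => simp
      | cast i =>
        cases j using Fin.lastCases with
        | last => exact absurd hij (Fin.castSucc_lt_last i).not_gt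
        | cast j => simpa using hw.2 i j (by simpa using hij)
    · intro i j h1 hij h2
      cases i using Fin.lastCases with
      | last => exact absurd hij (Fin.le_last j).not_gt
      | cast i =>
        cases j using Fin.lastCases with
        | last => simpa using (hupper _ _ h1 hij h2).mul_memO hcinv
        | cast j => simpa using hw1 i j (by simpa using h1) (by simpa using hij) (by simpa using h2)
    · intro i
      cases i using Fin.lastCases with
      | last => simpa using hc1
      | cast i => simpa using hd i
    · intro i
      cases i using Fin.lastCases <;> simp [hl.1]
    · intro i j hij
      cases i using Fin.lastCases with
      | last => exact absurd hij (Fin.le_last j).not_gt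
      | cast i =>
        cases j using Fin.lastCases with
        | last => simp
        | cast j => simpa using hl.2 i j (by simpa using hij)
    · refine Matrix.ext fun i j => ?_
      refine Eq.trans ?_ (mul_diagonal_mul_apply _ _ _ i j).symm
      rw [Fin.sum_univ_castSucc]
      cases i using Fin.lastCases with
      | last =>
        cases j using Fin.lastCases with
        | last => simp [hc]
        | cast j => simp; field_simp
      | cast i =>
        cases j using Fin.lastCases with
        | last => simp; field_simp
        | cast j =>
          have h := congrFun (congrFun hM i) j
          rw [mul_diagonal_mul_apply] at h
          simp only [Fin.lastCases_castSucc, Fin.lastCases_last]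
          rw [← h]
          field_simp
          ring

end Gauss

section Zastava

variable {n r₁ k : ℕ}

theorem Cc_neg (z : ℂ) : Cc (-z) = -Cc z := map_neg _ z

theorem ymat_mul_first_row (hn : r₁ - 1 + k < n) (p e : ℂ) (b g : Fin (k - 1) → ℂ)
    (A : Matrix (Fin n) (Fin n) K) (j : Fin n) :
    (blockEmbed n r₁ k (ymat k p e b g) * A) ⟨r₁ - 1, by omega⟩ j =
      Cc e * A ⟨r₁ - 1 + k, hn⟩ j := by
  refine (blockEmbed_mul_apply_mem hn (ymat k p e b g) A 0 j).trans ?_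
  rw [Finset.sum_eq_single (Fin.last k)]
  · simp [ymat]
  · intro s _ hs
    have : (s : ℕ) ≠ k := fun h => hs (Fin.ext h)
    simp [ymat, this]
  · simp

theorem ymat_mul_middle_row (hn : r₁ - 1 + k < n) (p e : ℂ) (b g : Fin (k - 1) → ℂ)
    (A : Matrix (Fin n) (Fin n) K) (i : Fin n) (hi : r₁ - 1 < (i : ℕ))
    (hi' : (i : ℕ) < r₁ - 1 + k) :
    ∃ β : ℂ, ∀ j, (blockEmbed n r₁ k (ymat k p e b g) * A) i j =
      A i j + Cc β * A ⟨r₁ - 1 + k, hn⟩ j := by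
  obtain ⟨q, h, rfl⟩ := exists_block_index ⟨hi.le, hi'.le⟩
  simp only at hi hi'
  have hq0 : (q : ℕ) ≠ 0 := by omega
  have hqk : (q : ℕ) ≠ k := by omega
  refine ⟨b ⟨k - (q : ℕ) - 1, by omega⟩, fun j => ?_⟩
  rw [blockEmbed_mul_apply_mem hn, Finset.sum_eq_add_of_mem q (Fin.last k)
    (Finset.mem_univ _) (Finset.mem_univ _) (fun h => hqk (by simp [h]))]
  · simp [ymat, hq0, hqk, hqk.symm]
  · rintro s _ ⟨h1, h2⟩
    have h1' : (s : ℕ) ≠ q := fun h => h1 (Fin.ext h)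
    have h2' : (s : ℕ) ≠ k := fun h => h2 (Fin.ext h)
    simp [ymat, hq0, hqk, h1', h2']

theorem ymat_mul_last_row (hk : 1 ≤ k) (hn : r₁ - 1 + k < n) (p e : ℂ) (b g : Fin (k - 1) → ℂ)
    (A : Matrix (Fin n) (Fin n) K) (hA : ∀ i j : Fin n, j < i → A i j = 0)
    (hAO : ∀ i j, memO (A i j)) :
    ∃ (c : ℂ) (S : Fin n → K), (∀ j, memO (S j)) ∧ (∀ j : Fin n, (j : ℕ) < r₁ - 1 → S j = 0) ∧
      S ⟨r₁ - 1, by omega⟩ = -(Cc e⁻¹ * A ⟨r₁ - 1, by omega⟩ ⟨r₁ - 1, by omega⟩) ∧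
      ∀ j, (blockEmbed n r₁ k (ymat k p e b g) * A) ⟨r₁ - 1 + k, hn⟩ j =
        S j + (tK - Cc c) * A ⟨r₁ - 1 + k, hn⟩ j := by
  have hk0 : k ≠ 0 := by omega
  have hconst : ∀ s : Fin k, ∃ z : ℂ, ymat k p e b g (Fin.last k) s.castSucc = Cc z := by
    intro s
    have hs : (s : ℕ) ≠ k := s.isLt.ne
    by_cases h0 : (s : ℕ) = 0
    · exact ⟨-e⁻¹, by simp [ymat, hk0, h0]⟩
    · refine ⟨-(g ⟨k - (s : ℕ) - 1, by omega⟩), by simp [ymat, hk0, h0, hs]⟩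
  refine ⟨p + ∑ l, b l * g l, fun j => ∑ s : Fin k,
    ymat k p e b g (Fin.last k) s.castSucc * A ⟨r₁ - 1 + s, by omega⟩ j, ?_, ?_, ?_, ?_⟩
  · intro j
    refine memO_sum _ fun s _ => ?_
    obtain ⟨z, hz⟩ := hconst s
    rw [hz]
    exact (memO_C z).mul (hAO _ _)
  · intro j hj
    refine Finset.sum_eq_zero fun s _ => ?_
    rw [hA _ _ (by rw [Fin.lt_def]; simp only; omega), mul_zero]
  · simp only
    rw [Finset.sum_eq_single ⟨0, by omega⟩]
    · simp only [Fin.val_last, Fin.val_castSucc, ymat, dif_neg hk0, dif_pos, Cc_neg]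
      exact neg_mul (Cc e⁻¹) _
    · intro s _ hs
      have hs0 : (s : ℕ) ≠ 0 := fun h => hs (Fin.ext h)
      rw [hA _ _ (by rw [Fin.lt_def]; simp only; omega), mul_zero]
    · simp
  · intro j
    refine (blockEmbed_mul_apply_mem hn (ymat k p e b g) A (Fin.last k) j).trans ?_
    rw [Fin.sum_univ_castSucc]
    simp [ymat, hk0]

/-- The column operations on `τ_α(y(p,e,b,g))·A` bring it into the form handled by
`exists_gauss_of_block`. -/
theorem exists_gauss_ymat_mul (hk : 1 ≤ k) (hn : r₁ - 1 + k < n) (p e : ℂ) (he : e ≠ 0)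
    (b g : Fin (k - 1) → ℂ) (A : Matrix (Fin n) (Fin n) K) (hdiag : ∀ i, memO1 (A i i - 1))
    (hoff : ∀ i j, i ≠ j → memO1 (A i j)) (hA : ∀ i j : Fin n, j < i → A i j = 0)
    (a : Fin n → K) (halo : a ⟨r₁ - 1, by omega⟩ = tK) (hahi : a ⟨r₁ - 1 + k, hn⟩ = tK⁻¹)
    (ha : ∀ i : Fin n, (i : ℕ) ≠ r₁ - 1 → (i : ℕ) ≠ r₁ - 1 + k → a i = 1) :
    ∃ (w l : Matrix (Fin n) (Fin n) K) (d : Fin n → K), IsUpperUni w ∧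
      (∀ i j : Fin n, r₁ - 1 ≤ (i : ℕ) → i < j → (j : ℕ) ≤ r₁ - 1 + k → memO1 (w i j)) ∧
      (∀ i, memO1 (d i - 1)) ∧ IsLowerUni l ∧
      blockEmbed n r₁ k (ymat k p e b g) * A * Matrix.diagonal a *
        Matrix.transvection ⟨r₁ - 1 + k, hn⟩ ⟨r₁ - 1, by omega⟩ (Cc e⁻¹ * tK) =
        w * Matrix.diagonal d * l := by
  have ht := tK_ne_zero
  have hee : Cc e⁻¹ * Cc e = 1 := by simp [Cc, he, -HahnSeries.C_apply]
  have hAO : ∀ i j, memO (A i j) := by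
    intro i j
    by_cases h : i = j
    · subst h; exact memO_of_one_add (hdiag i)
    · exact (hoff i j h).integral
  obtain ⟨c, S, hSO, hS0, hSlo, hlast⟩ := ymat_mul_last_row hk hn p e b g A hA hAO
  have hfirst := ymat_mul_first_row hn p e b g A
  have hmid := ymat_mul_middle_row hn p e b g A
  have hout := fun i j => blockEmbed_mul_apply_of_notMem (r₁ := r₁) (ymat k p e b g) A i j
  set Z := blockEmbed n r₁ k (ymat k p e b g) * A
  set lo : Fin n := ⟨r₁ - 1, by omega⟩
  set hi : Fin n := ⟨r₁ - 1 + k, hn⟩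
  have hlov : (lo : ℕ) = r₁ - 1 := rfl
  have hhiv : (hi : ℕ) = r₁ - 1 + k := rfl
  set M := Z * Matrix.diagonal a * Matrix.transvection hi lo (Cc e⁻¹ * tK) with hMdef
  have hne : hi ≠ lo := fun h => by rw [Fin.ext_iff] at h; omega
  have Mlo : ∀ i, M i lo = Z i lo * tK + Cc e⁻¹ * Z i hi := by
    intro i
    rw [hMdef, Matrix.mul_transvection_apply_same, Matrix.mul_diagonal, Matrix.mul_diagonal, halo, hahi]
    field_simp
  have Mhi : ∀ i, M i hi = Z i hi * tK⁻¹ := by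
    intro i
    rw [hMdef, Matrix.mul_transvection_apply_of_ne _ _ _ _ hne, Matrix.mul_diagonal, hahi]
  have Mne : ∀ i j, j ≠ lo → j ≠ hi → M i j = Z i j := by
    intro i j h1 h2
    rw [hMdef, Matrix.mul_transvection_apply_of_ne _ _ _ _ h1, Matrix.mul_diagonal,
      ha j (fun h => h1 (Fin.ext h)) (fun h => h2 (Fin.ext h)), mul_one]
  have hlast' : ∀ j, j < hi → Z hi j = S j := by
    intro j hj
    rw [hlast, hA _ _ hj, mul_zero, add_zero]
  have hmid' : ∀ i : Fin n, lo < i → i < hi → ∀ j < hi, Z i j = A i j := by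
    intro i h1 h2 j hj
    obtain ⟨β, hβ⟩ := hmid i h1 h2
    rw [hβ, hA _ _ hj, mul_zero, add_zero]
  have hmidO : ∀ i : Fin n, lo < i → i < hi → ∀ j, memO (Z i j) := by
    intro i h1 h2 j
    obtain ⟨β, hβ⟩ := hmid i h1 h2
    rw [hβ]
    exact (hAO _ _).add ((memO_C β).mul (hAO _ _))
  have hcases : ∀ i : Fin n, i < lo ∨ i = lo ∨ (lo < i ∧ i < hi) ∨ i = hi ∨ hi < i := by
    intro i
    simp only [Fin.lt_def, Fin.ext_iff]
    omega
  have hlohi : lo < hi := by rw [Fin.lt_def]; omega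
  have hZhihi : ∃ x, memO x ∧ Z hi hi = x + tK * A hi hi :=
    ⟨S hi - Cc c * A hi hi, (hSO _).sub ((memO_C c).mul (hAO _ _)), by rw [hlast]; ring⟩
  have hout' : ∀ i j, (i < lo ∨ hi < i) → Z i j = A i j := by
    intro i j h
    refine hout i j ?_
    simp only [Fin.lt_def] at h
    omega
  refine exists_gauss_of_block (r₁ - 1) (r₁ - 1 + k) n M ?_ ?_ ?_ ?_
  · intro i
    rcases hcases i with h | rfl | ⟨h, h'⟩ | rfl | h
    · rw [Mne i i h.ne (h.trans hlohi).ne, hout' i i (Or.inl h)]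
      exact hdiag i
    · rw [Mlo, hfirst, hfirst, hA _ _ hlohi, ← mul_assoc, hee]
      simpa using hdiag hi
    · rw [Mne i i h.ne' h'.ne, hmid' i h h' i h']
      exact hdiag i
    · obtain ⟨x, hx, hZ⟩ := hZhihi
      have : M hi hi - 1 = x * tK⁻¹ + (A hi hi - 1) := by
        rw [Mhi, hZ]; field_simp; ring
      rw [this]
      exact (hx.mul_memO1 memO1_tK_inv).add (hdiag hi)
    · rw [Mne i i (hlohi.trans h).ne' h.ne', hout' i i (Or.inr h)]
      exact hdiag i
  · intro i j h1 h2 h3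
    have h1' : lo ≤ i := h1
    have h3' : j ≤ hi := h3
    have hjlo : j ≠ lo := (h1'.trans_lt h2).ne'
    rcases h3'.eq_or_lt with rfl | hj
    · rw [Mhi]
      refine memO.mul_memO1 ?_ memO1_tK_inv
      rcases h1'.eq_or_lt with rfl | h
      · rw [hfirst]
        exact (memO_C e).mul (hAO _ _)
      · exact hmidO i h h2 _
    · rw [Mne i j hjlo hj.ne]
      rcases h1'.eq_or_lt with rfl | h
      · rw [hfirst, hA _ _ hj, mul_zero]
        exact memO1_zero
      · rw [hmid' i h (h2.trans hj) j hj]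
        exact hoff i j h2.ne
  · intro i j hij
    rcases hcases i with h | rfl | ⟨h, h'⟩ | rfl | h
    · rw [Mne i j (hij.trans h).ne (hij.trans (h.trans hlohi)).ne, hout' i j (Or.inl h)]
      exact hAO i j
    · rw [Mne _ j hij.ne (hij.trans hlohi).ne, hfirst]
      exact (memO_C e).mul (hAO _ _)
    · by_cases hj : j = lo
      · rw [hj, Mlo, hmid' i h h' lo hlohi, hA i lo h, zero_mul, zero_add]
        exact (memO_C _).mul (hmidO i h h' hi)
      · rw [Mne i j hj (hij.trans h').ne]
        exact hmidO i h h' j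
    · by_cases hj : j = lo
      · obtain ⟨x, hx, hZ⟩ := hZhihi
        have : M hi j = Cc e⁻¹ * (x + tK * ((A hi hi - 1) - (A lo lo - 1))) := by
          rw [hj, Mlo, hlast' lo hlohi, hSlo, hZ]; ring
        rw [this]
        exact (memO_C _).mul (hx.add ((hdiag hi).sub (hdiag lo)).tK_mul)
      · rw [Mne _ j hj hij.ne, hlast' j hij]
        exact hSO j
    · by_cases hj : j = lo
      · rw [hj, Mlo, hout' _ _ (Or.inr h), hout' _ _ (Or.inr h), hA _ _ (hlohi.trans h), hA _ _ h]
        simpa using memO_zero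
      · by_cases hj' : j = hi
        · rw [hj', Mhi, hout' _ _ (Or.inr h), hA _ _ h, zero_mul]
          exact memO_zero
        · rw [Mne i j hj hj', hout' _ _ (Or.inr h)]
          exact hAO i j
  · rintro i j hij (hj | hi')
    · have hj : j < lo := hj
      rw [Mne i j hj.ne (hj.trans hlohi).ne]
      rcases hcases i with h | rfl | ⟨h, h'⟩ | rfl | h
      · rw [hout' _ _ (Or.inl h), hA _ _ hij]
      · rw [hfirst, hA _ _ (hj.trans hlohi), mul_zero]
      · rw [hmid' i h h' j (hj.trans hlohi), hA _ _ hij]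
      · rw [hlast' j hij, hS0 j hj]
      · rw [hout' _ _ (Or.inr h), hA _ _ hij]
    · have h : hi < i := hi'
      by_cases hj : j = lo
      · rw [hj, Mlo, hout' _ _ (Or.inr h), hout' _ _ (Or.inr h), hA _ _ (hlohi.trans h), hA _ _ h]
        simp
      · by_cases hj' : j = hi
        · rw [hj', Mhi, hout' _ _ (Or.inr h), hA _ _ h, zero_mul]
        · rw [Mne i j hj hj', hout' _ _ (Or.inr h), hA _ _ hij]

end Zastava

section LowerUni

variable {n : ℕ}

theorem IsLowerUni.mul {R : Type*} [CommRing R] {A B : Matrix (Fin n) (Fin n) R}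
    (hA : IsLowerUni A) (hB : IsLowerUni B) : IsLowerUni (A * B) := by
  constructor
  · intro i
    rw [Matrix.mul_apply, Finset.sum_eq_single i, hA.1, hB.1, one_mul]
    · intro x _ hx
      rcases lt_or_gt_of_ne hx with h | h
      · rw [hB.2 _ _ h, mul_zero]
      · rw [hA.2 _ _ h, zero_mul]
    · simp
  · intro i j hij
    rw [Matrix.mul_apply]
    refine Finset.sum_eq_zero fun x _ => ?_
    rcases lt_or_ge i x with h | h
    · rw [hA.2 _ _ h, zero_mul]
    · rw [hB.2 _ _ (h.trans_lt hij), mul_zero]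

theorem isLowerUni_transvection {R : Type*} [CommRing R] {i j : Fin n} (h : j < i) (c : R) :
    IsLowerUni (Matrix.transvection i j c) := by
  constructor
  · intro x
    have : ¬ (i = x ∧ j = x) := fun ⟨h1, h2⟩ => h.ne (h2.trans h1.symm)
    simp [Matrix.transvection, this]
  · intro x y hxy
    have : ¬ (i = x ∧ j = y) := fun ⟨h1, h2⟩ => by subst h1 h2; exact lt_asymm h hxy
    simp [Matrix.transvection, this, hxy.ne]

theorem IsLowerUni.conj_tPow {A : Matrix (Fin n) (Fin n) K} (hA : IsLowerUni A)
    (ν : Fin n → ℤ) : IsLowerUni (tPow (-ν) * A * tPow ν) := by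
  constructor
  · intro i
    rw [tPow, tPow, Matrix.mul_diagonal, Matrix.diagonal_mul, hA.1]
    simp [zpow_ne_zero (ν i) tK_ne_zero]
  · intro i j hij
    rw [tPow, tPow, Matrix.mul_diagonal, Matrix.diagonal_mul, hA.2 _ _ hij]
    simp

theorem tPow_mul_tPow (μ ν : Fin n → ℤ) : tPow μ * tPow ν = tPow (μ + ν) := by
  rw [tPow, tPow, tPow, Matrix.diagonal_mul_diagonal]
  simp [zpow_add₀ tK_ne_zero]

end LowerUni

/-- For `y₁ = τ_α(y(p,e,b,g)) ∈ Gr⁰_{−α}` and `y₂ ∈ Gr_{μ+α}`, the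
product `y₁·y₂` lies in `N(K)^α₁ · t^μ · T₁[[t⁻¹]] · N₋(K)`. -/
theorem statement7 (n r₁ r₂ k : ℕ) (hn : 2 ≤ n) (hr1 : 1 ≤ r₁) (hrr : r₁ ≤ r₂)
    (hrn : r₂ < n) (hk : k = r₂ - r₁ + 1) (μ : Fin n → ℤ)
    (p e : ℂ) (he : e ≠ 0) (b g : Fin (k-1) → ℂ)
    (y₂ : Matrix (Fin n) (Fin n) K) (hy₂ : y₂ ∈ GrSlice (addAlpha n r₁ r₂ μ)) :
    ∃ w h l : Matrix (Fin n) (Fin n) K,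
      MemNKalpha1 n r₁ k w ∧ MemT1 h ∧ IsLowerUni l ∧
      blockEmbed n r₁ k (ymat k p e b g) * y₂ = w * tPow μ * h * l := by
  obtain ⟨u, h, l, hu, hh, hl, rfl⟩ := hy₂
  have hk1 : 1 ≤ k := by omega
  have hn' : r₁ - 1 + k < n := by omega
  have hr₂ : r₂ = r₁ - 1 + k := by omega
  have hhd : h = Matrix.diagonal fun i => h i i := by
    refine Matrix.ext fun i j => ?_
    rw [Matrix.diagonal_apply]
    split_ifs with hij
    · rw [hij]
    · exact hh.1 i j hij
  have hentry : ∀ i j, (u * h) i j = u i j * h j j := by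
    intro i j
    rw [hhd, Matrix.mul_diagonal, Matrix.diagonal_apply_eq]
  obtain ⟨w, l', d, hw, hw1, hd, hl', hM⟩ := exists_gauss_ymat_mul (r₁ := r₁) hk1 hn' p e he b g
    (u * h) (fun i => by rw [hentry, hu.1.1, one_mul]; exact hh.2 i)
    (fun i j hij => by rw [hentry]; exact (hu.2 i j hij).mul_memO (memO_of_one_add (hh.2 j)))
    (fun i j hij => by rw [hentry, hu.1.2 i j hij, zero_mul])
    (fun i => tK ^ alphaCo n r₁ r₂ i) (by simp [alphaCo])
    (by simp [alphaCo, hr₂, show k ≠ 0 by omega])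
    (fun i h1 h2 => by simp [alphaCo, h1, hr₂, h2])
  set x : K := Cc e⁻¹ * tK
  set lo : Fin n := ⟨r₁ - 1, by omega⟩
  set hi : Fin n := ⟨r₁ - 1 + k, hn'⟩
  have hlohi : lo < hi := by rw [Fin.lt_def]; simp only [lo, hi]; omega
  have htr : Matrix.transvection hi lo x * Matrix.transvection hi lo (-x) = 1 := by
    rw [Matrix.transvection_mul_transvection_same _ _ hlohi.ne']
    simp
  refine ⟨w, Matrix.diagonal d,
    tPow (-μ) * (l' * Matrix.transvection hi lo (-x)) * tPow μ * l,
    memNKalpha1_of_isUpperUni hn' hw hw1, ⟨fun i j hij => Matrix.diagonal_apply_ne _ hij,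
      fun i => by simpa using hd i⟩,
    ((hl'.mul (isLowerUni_transvection hlohi _)).conj_tPow μ).mul hl.1, ?_⟩
  have hadd : tPow (addAlpha n r₁ r₂ μ) = tPow (alphaCo n r₁ r₂) * tPow μ := by
    rw [tPow_mul_tPow, add_comm]
    rfl
  have hcomm : tPow μ * Matrix.diagonal d * tPow (-μ) = Matrix.diagonal d := by
    simp only [tPow, Matrix.diagonal_mul_diagonal]
    congr 1
    funext i
    have := zpow_ne_zero (μ i) tK_ne_zero
    simp only [Pi.neg_apply, _root_.zpow_neg]
    field_simp
  calc blockEmbed n r₁ k (ymat k p e b g) * (u * h * tPow (addAlpha n r₁ r₂ μ) * l)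
      = blockEmbed n r₁ k (ymat k p e b g) * (u * h) * tPow (alphaCo n r₁ r₂) *
          (Matrix.transvection hi lo x * Matrix.transvection hi lo (-x)) * tPow μ * l := by
        rw [htr, hadd]
        simp only [Matrix.mul_assoc, Matrix.one_mul]
    _ = blockEmbed n r₁ k (ymat k p e b g) * (u * h) * tPow (alphaCo n r₁ r₂) *
          Matrix.transvection hi lo x * (Matrix.transvection hi lo (-x) * tPow μ * l) := by
        simp only [Matrix.mul_assoc]
    _ = w * Matrix.diagonal d * l' * (Matrix.transvection hi lo (-x) * tPow μ * l) := by
        rw [← hM]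
        rfl
    _ = w * (tPow μ * Matrix.diagonal d * tPow (-μ)) * l' *
          (Matrix.transvection hi lo (-x) * tPow μ * l) := by rw [hcomm]
    _ = w * tPow μ * Matrix.diagonal d *
          (tPow (-μ) * (l' * Matrix.transvection hi lo (-x)) * tPow μ * l) := by
        simp only [Matrix.mul_assoc]

end
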